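/- Let 𝔤 be a finite-dimensional semisimple Lie algebra over a field of characteristic 0. Then the universal enveloping algebra decomposes as a direct sum of vector spaces U(𝔤) = Z(U(𝔤)) ⊕ [U(𝔤),U(𝔤)], where Z(U(𝔤)) is the center of U(𝔤) and [U(𝔤),U(𝔤)] is the linear span of commutators xy − yx, x,y ∈ U(𝔤). -/

import Mathlib

namespace UEAux

attribute [local instance] LieRing.ofAssociativeRing

section weyl
variable {k : Type*} [Field k] [CharZero k] {L : Type*} [LieRing L] [LieAlgebra k L]

/-- The span of all `⁅x, v⁆`. -/
def cov (k L V : Type*) [Field k] [LieRing L] [LieAlgebra k L]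
    [AddCommGroup V] [Module k V] [LieRingModule L V] : Submodule k V :=
  Submodule.span k {m : V | ∃ (x : L) (v : V), ⁅x, v⁆ = m}

lemma perfect [FiniteDimensional k L] [LieAlgebra.IsKilling k L] :
    LieAlgebra.derivedSeries k L 1 = ⊤ := by
  set D := LieAlgebra.derivedSeries k L 1 with hD
  have hmem : ∀ x y : L, ⁅x, y⁆ ∈ D := by
    intro x y
    rw [hD, LieAlgebra.derivedSeries_def, LieAlgebra.derivedSeriesOfIdeal_succ,
      LieAlgebra.derivedSeriesOfIdeal_zero]
    exact LieSubmodule.lie_mem_lie trivial trivial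
  have hc := D.isCompl_killingCompl
  have : IsLieAbelian (D.killingCompl) := by
    rw [LieSubmodule.lie_abelian_iff_lie_self_eq_bot, LieSubmodule.lie_eq_bot_iff]
    intro x hx y hy
    have h1 : ⁅x, y⁆ ∈ D ⊓ D.killingCompl := ⟨hmem x y, LieSubmodule.lie_mem _ hy⟩
    rw [hc.inf_eq_bot] at h1
    simpa using h1
  have hb := LieAlgebra.IsKilling.ideal_eq_bot_of_isLieAbelian D.killingCompl
  have := hc.sup_eq_top
  rwa [hb, sup_bot_eq] at this

lemma casimir {V : Type*} [AddCommGroup V] [Module k V] [LieRingModule L V] [LieModule k L V]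
    [FiniteDimensional k V] [FiniteDimensional k L] (I : LieIdeal k L)
    (hI : ((LieModule.traceForm k L V).restrict I.toSubmodule).Nondegenerate) :
    ∃ C : Module.End k V, (∀ (x : L) (v : V), C ⁅x, v⁆ = ⁅x, C v⁆) ∧
      LinearMap.trace k V C = Module.finrank k I.toSubmodule ∧
      (∀ v, C v ∈ cov k L V) ∧ (∀ v : V, (∀ x : L, ⁅x, v⁆ = 0) → C v = 0) := by
  classical
  set B := (LieModule.traceForm k L V).restrict I.toSubmodule with hB
  have hsym : B.IsSymm := ⟨fun x y => LieModule.traceForm_comm k L V x y⟩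
  let b := Module.finBasis k I.toSubmodule
  let b' := B.dualBasis hI b
  have hb' : B.dualBasis hI b' = b := LinearMap.BilinForm.dualBasis_dualBasis hI hsym b
  have e1 : ∀ z (hz : z ∈ I), z = ∑ j, B ⟨z, hz⟩ (b' j) • (b j : L) := by
    intro z hz
    have := b.sum_repr ⟨z, hz⟩
    have h2 := congrArg (Subtype.val) this
    rw [← hb'] at h2
    simp only [LinearMap.BilinForm.dualBasis_repr_apply] at h2
    rw [hb'] at h2
    simpa using h2.symm
  have e2 : ∀ z (hz : z ∈ I), z = ∑ j, B ⟨z, hz⟩ (b j) • (b' j : L) := by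
    intro z hz
    have := b'.sum_repr ⟨z, hz⟩
    have h2 := congrArg (Subtype.val) this
    simp only [b', LinearMap.BilinForm.dualBasis_repr_apply] at h2
    simpa using h2.symm
  let C : Module.End k V := ∑ i, LieModule.toEnd k L V (b i) ∘ₗ LieModule.toEnd k L V (b' i)
  have hC : ∀ v, C v = ∑ i, ⁅(b i : L), ⁅(b' i : L), v⁆⁆ := by
    intro v; simp [C, LinearMap.sum_apply]
  refine ⟨C, ?_, ?_, ?_, ?_⟩
  · intro x v
    have m1 : ∀ i, ⁅x, (b i : L)⁆ ∈ I := fun i => LieSubmodule.lie_mem _ (b i).2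
    have m2 : ∀ i, ⁅x, (b' i : L)⁆ ∈ I := fun i => LieSubmodule.lie_mem _ (b' i).2
    have key : ∑ i, (⁅⁅x, (b i : L)⁆, ⁅(b' i : L), v⁆⁆ + ⁅(b i : L), ⁅⁅x, (b' i : L)⁆, v⁆⁆) = 0 := by
      have s1 : ∀ i, ⁅⁅x, (b i : L)⁆, ⁅(b' i : L), v⁆⁆ =
          ∑ j, B ⟨_, m1 i⟩ (b' j) • ⁅(b j : L), ⁅(b' i : L), v⁆⁆ := by
        intro i
        conv_lhs => rw [e1 _ (m1 i)]
        simp [sum_lie]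
      have s2 : ∀ i, ⁅(b i : L), ⁅⁅x, (b' i : L)⁆, v⁆⁆ =
          ∑ j, B ⟨_, m2 i⟩ (b j) • ⁅(b i : L), ⁅(b' j : L), v⁆⁆ := by
        intro i
        conv_lhs => rw [e2 _ (m2 i)]
        simp [sum_lie, lie_sum]
      rw [Finset.sum_add_distrib]
      simp only [s1, s2]
      rw [Finset.sum_comm, ← Finset.sum_add_distrib]
      refine Finset.sum_eq_zero fun i _ => ?_
      rw [← Finset.sum_add_distrib]
      refine Finset.sum_eq_zero fun j _ => ?_
      rw [← add_smul]
      have : B ⟨_, m1 j⟩ (b' i) + B ⟨_, m2 i⟩ (b j) = 0 := by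
        change LieModule.traceForm k L V ⁅x, (b j : L)⁆ (b' i) +
          LieModule.traceForm k L V ⁅x, (b' i : L)⁆ (b j) = 0
        rw [LieModule.traceForm_apply_lie_apply', LieModule.traceForm_comm k L V (b j : L)]
        simp
      rw [this, zero_smul]
    rw [hC, hC, lie_sum, ← sub_eq_zero, ← neg_eq_zero, ← key, ← Finset.sum_sub_distrib,
      ← Finset.sum_neg_distrib]
    refine Finset.sum_congr rfl fun i _ => ?_
    simp only [lie_lie, lie_sub]
    abel
  · simp only [C, map_sum]
    have : ∀ i, LinearMap.trace k V
        (LieModule.toEnd k L V (b i) ∘ₗ LieModule.toEnd k L V (b' i)) = 1 := by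
      intro i
      have := LinearMap.BilinForm.apply_dualBasis_right (B := B) hI hsym b i i
      rw [if_pos rfl] at this
      exact this
    simp [this]
  · intro v
    rw [hC]
    exact Submodule.sum_mem _ fun i _ => Submodule.subset_span ⟨_, _, rfl⟩
  · intro v hv
    rw [hC]
    simp [hv]

lemma trivial_of_traceForm [FiniteDimensional k L] [LieAlgebra.IsKilling k L]
    {V : Type*} [AddCommGroup V] [Module k V] [LieRingModule L V] [LieModule k L V]
    [FiniteDimensional k V] (h : LieModule.traceForm k L V = 0) (x : L) (v : V) : ⁅x, v⁆ = 0 := by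
  have h1 := LieModule.isNilpotent_derivedSeries_of_traceForm_eq_zero h
  have h2 : LieModule.IsNilpotent L V := by
    rw [LieModule.isNilpotent_iff_forall' (R := k)] at h1 ⊢
    intro x
    have hx : x ∈ LieAlgebra.derivedSeries k L 1 := by rw [perfect]; trivial
    exact h1 ⟨x, hx⟩
  have h3 : LieModule.lowerCentralSeries k L V 1 ≤ LieModule.lowerCentralSeries k L V 2 := by
    rw [LieModule.lowerCentralSeries_succ, LieSubmodule.lie_le_iff]
    intro x _ m _
    have hx : x ∈ LieAlgebra.derivedSeries k L 1 := by rw [perfect]; trivial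
    rw [LieAlgebra.derivedSeries_def, LieAlgebra.derivedSeriesOfIdeal_succ,
      LieAlgebra.derivedSeriesOfIdeal_zero, ← LieSubmodule.mem_toSubmodule,
      LieSubmodule.lieIdeal_oper_eq_linear_span'] at hx
    induction hx using Submodule.span_induction with
    | mem z hz =>
      obtain ⟨a, -, c, -, rfl⟩ := hz
      rw [lie_lie]
      refine sub_mem ?_ ?_ <;>
      · simp only [LieModule.lowerCentralSeries_succ, LieModule.lowerCentralSeries_zero]
        exact LieSubmodule.lie_mem_lie trivial (LieSubmodule.lie_mem_lie trivial trivial)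
    | zero => simp
    | add a c _ _ ha hc => rw [add_lie]; exact add_mem (ha trivial) (hc trivial)
    | smul t a _ ha => rw [smul_lie]; exact SMulMemClass.smul_mem _ (ha trivial)
  have h4 : ∀ n, LieModule.lowerCentralSeries k L V 1 ≤ LieModule.lowerCentralSeries k L V n := by
    intro n
    induction n with
    | zero => simp
    | succ n ih =>
      refine h3.trans ?_
      rw [LieModule.lowerCentralSeries_succ k L V 1, LieModule.lowerCentralSeries_succ k L V n]
      exact LieSubmodule.mono_lie_right _ ih
  obtain ⟨n, hn⟩ := LieModule.IsNilpotent.nilpotent k L V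
  have h5 : ⁅x, v⁆ ∈ LieModule.lowerCentralSeries k L V 1 := by
    rw [LieModule.lowerCentralSeries_succ]
    exact LieSubmodule.lie_mem_lie trivial trivial
  have := h4 n h5
  rw [hn] at this
  simpa using this

lemma exists_casimir [FiniteDimensional k L] [LieAlgebra.IsKilling k L]
    {V : Type*} [AddCommGroup V] [Module k V] [LieRingModule L V] [LieModule k L V]
    [FiniteDimensional k V] (h : LieModule.traceForm k L V ≠ 0) :
    ∃ C : Module.End k V, (∀ (x : L) (v : V), C ⁅x, v⁆ = ⁅x, C v⁆) ∧
      LinearMap.trace k V C ≠ 0 ∧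
      (∀ v, C v ∈ cov k L V) ∧ (∀ v : V, (∀ x : L, ⁅x, v⁆ = 0) → C v = 0) := by
  let K : LieIdeal k L := LieAlgebra.InvariantForm.orthogonal (LieModule.traceForm k L V)
    (LieModule.traceForm_lieInvariant k L V) ⊤
  have hK : ∀ y, y ∈ K ↔ ∀ x, LieModule.traceForm k L V x y = 0 := by
    intro y
    simp [K, LieAlgebra.InvariantForm.mem_orthogonal]
  have hc := K.isCompl_killingCompl
  set I := K.killingCompl
  have hnd : ((LieModule.traceForm k L V).restrict I.toSubmodule).Nondegenerate := by
    have hsym : ((LieModule.traceForm k L V).restrict I.toSubmodule).IsSymm :=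
      ⟨fun x y => LieModule.traceForm_comm k L V x y⟩
    refine hsym.isRefl.nondegenerate_iff_separatingLeft.mpr ?_
    rintro ⟨x, hx⟩ hxy
    have hxK : x ∈ K := by
      rw [hK]
      intro y
      have hy : y ∈ K ⊔ I := by rw [hc.sup_eq_top]; trivial
      obtain ⟨a, ha, c, hc', rfl⟩ := (LieSubmodule.mem_sup _ _ _).1 hy
      have t1 := (hK a).1 ha x
      have t2 : LieModule.traceForm k L V x c = 0 := hxy ⟨c, hc'⟩
      rw [LieModule.traceForm_comm, map_add, t1, t2, add_zero]
    have : x ∈ K ⊓ I := ⟨hxK, hx⟩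
    rw [hc.inf_eq_bot] at this
    simpa using this
  obtain ⟨C, h1, h2, h3, h4⟩ := casimir I hnd
  refine ⟨C, h1, ?_, h3, h4⟩
  rw [h2]
  intro h0
  apply h
  have h0' : Module.finrank k I.toSubmodule = 0 := by exact_mod_cast h0
  rw [Submodule.finrank_eq_zero] at h0'
  have hI : I = ⊥ := by simpa using h0'
  have hKt : K = ⊤ := by
    have := hc.sup_eq_top
    rwa [hI, sup_bot_eq] at this
  ext x y
  exact (hK y).1 (by rw [hKt]; trivial) x


theorem weyl [FiniteDimensional k L] [LieAlgebra.IsKilling k L] (n : ℕ) :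
    ∀ (V : Type*) [AddCommGroup V] [Module k V] [LieRingModule L V] [LieModule k L V]
    [FiniteDimensional k V], Module.finrank k V = n →
    IsCompl (LieModule.maxTrivSubmodule k L V).toSubmodule (cov k L V) := by
  induction n using Nat.strong_induction_on with
  | _ n ih =>
  intro V _ _ _ _ _ hn
  by_cases h : LieModule.traceForm k L V = 0
  · have htr := trivial_of_traceForm h
    have h1 : (LieModule.maxTrivSubmodule k L V).toSubmodule = ⊤ := by
      rw [eq_top_iff]
      intro v _ x
      exact htr x v
    have h2 : cov k L V = ⊥ := by
      rw [eq_bot_iff, cov, Submodule.span_le]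
      rintro _ ⟨x, v, rfl⟩
      simp [htr]
    rw [h1, h2]
    exact isCompl_top_bot
  obtain ⟨C, hC, htr, hcov, hinv⟩ := exists_casimir h
  obtain ⟨m, hm, hm0⟩ := (C.eventually_isCompl_ker_pow_range_pow.and
    (Filter.eventually_gt_atTop 0)).exists
  have hCm : ∀ (j : ℕ) (x : L) (v : V), (C ^ j) ⁅x, v⁆ = ⁅x, (C ^ j) v⁆ := by
    intro j x v
    induction j with
    | zero => simp
    | succ j ih => rw [pow_succ', Module.End.mul_apply, ih, hC, Module.End.mul_apply]
  let V0 : LieSubmodule k L V :=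
    { LinearMap.ker (C ^ m) with
      lie_mem := by
        intro x v hv
        change (C ^ m) v = 0 at hv
        change (C ^ m) ⁅x, v⁆ = 0
        rw [hCm, hv, lie_zero] }
  have hV0 : ∀ v, v ∈ V0 ↔ (C ^ m) v = 0 := fun v => Iff.rfl
  have hlt : Module.finrank k V0 < n := by
    rw [← hn]
    apply Submodule.finrank_lt (s := V0.toSubmodule)
    intro htop
    apply htr
    have hz : C ^ m = 0 := by
      ext v
      have : v ∈ V0.toSubmodule := by rw [htop]; trivial
      exact this
    exact (LinearMap.isNilpotent_trace_of_isNilpotent ⟨m, hz⟩).eq_zero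
  have hV := ih _ hlt V0 rfl
  have hinc : ∀ a : V0, a ∈ cov k L V0 → (a : V) ∈ cov k L V := by
    intro a ha
    have : cov k L V0 ≤ (cov k L V).comap V0.toSubmodule.subtype := by
      conv_lhs => rw [cov]
      rw [Submodule.span_le]
      rintro _ ⟨x, v, rfl⟩
      exact Submodule.subset_span ⟨x, v, rfl⟩
    exact this ha
  have hrange : ∀ v, (C ^ m) v ∈ cov k L V := by
    intro v
    obtain ⟨j, rfl⟩ := Nat.exists_eq_succ_of_ne_zero hm0.ne'
    rw [Nat.succ_eq_add_one, pow_succ', Module.End.mul_apply]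
    exact hcov _
  have hsplit : ∀ v, ∃ a : V0, ∃ w, v = a + (C ^ m) w := by
    intro v
    have hv : v ∈ LinearMap.ker (C ^ m) ⊔ LinearMap.range (C ^ m) := by
      rw [hm.sup_eq_top]; trivial
    obtain ⟨a, ha, _, ⟨w, rfl⟩, rfl⟩ := Submodule.mem_sup.1 hv
    exact ⟨⟨a, ha⟩, w, rfl⟩
  refine ⟨?_, ?_⟩
  · rw [Submodule.disjoint_def]
    intro v hv hvc
    have hv' : ∀ x : L, ⁅x, v⁆ = 0 := hv
    have hvV0 : v ∈ V0 := by
      obtain ⟨j, rfl⟩ := Nat.exists_eq_succ_of_ne_zero hm0.ne'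
      rw [hV0, Nat.succ_eq_add_one, pow_succ, Module.End.mul_apply, hinv v hv', map_zero]
    have hdec : ∃ a : V0, a ∈ cov k L V0 ∧ ∃ w, v = a + (C ^ m) w := by
      clear hv hv' hvV0
      rw [cov] at hvc
      induction hvc using Submodule.span_induction with
      | mem z hz =>
        obtain ⟨x, u, rfl⟩ := hz
        obtain ⟨a, w, rfl⟩ := hsplit u
        refine ⟨⁅x, a⁆, Submodule.subset_span ⟨x, a, rfl⟩, ⁅x, w⁆, ?_⟩
        rw [hCm, lie_add]; rfl
      | zero => exact ⟨0, zero_mem _, 0, by simp⟩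
      | add a c _ _ ha hc =>
        obtain ⟨a1, ha1, w1, rfl⟩ := ha
        obtain ⟨a2, ha2, w2, rfl⟩ := hc
        refine ⟨a1 + a2, add_mem ha1 ha2, w1 + w2, ?_⟩
        rw [map_add]; push_cast; abel
      | smul t a _ ha =>
        obtain ⟨a1, ha1, w1, rfl⟩ := ha
        refine ⟨t • a1, Submodule.smul_mem _ _ ha1, t • w1, ?_⟩
        rw [map_smul, smul_add]; rfl
    obtain ⟨a, ha, w, hw⟩ := hdec
    have hz : (C ^ m) w = 0 := by
      have h1 : (C ^ m) w ∈ LinearMap.ker (C ^ m) := by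
        have : (C ^ m) w = v - a := by rw [hw]; abel
        rw [this]
        exact sub_mem hvV0 a.2
      exact (Submodule.disjoint_def.1 hm.disjoint) _ h1 ⟨w, rfl⟩
    rw [hz, add_zero] at hw
    have hai : a ∈ (LieModule.maxTrivSubmodule k L V0).toSubmodule := by
      intro x
      apply Subtype.ext
      change ⁅x, (a : V)⁆ = 0
      rw [← hw]; exact hv' x
    have := (Submodule.disjoint_def.1 hV.disjoint) a hai ha
    rw [hw, this]; rfl
  · rw [codisjoint_iff, eq_top_iff]
    intro v _
    obtain ⟨a, w, rfl⟩ := hsplit v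
    refine add_mem ?_ (Submodule.mem_sup_right (hrange w))
    have ha : a ∈ (LieModule.maxTrivSubmodule k L V0).toSubmodule ⊔ cov k L V0 := by
      rw [hV.sup_eq_top]; trivial
    obtain ⟨b, hb, c, hc, rfl⟩ := Submodule.mem_sup.1 ha
    refine Submodule.add_mem_sup ?_ (hinc c hc)
    intro x
    exact congrArg Subtype.val (hb x)

end weyl

section uea
variable (k : Type*) [Field k] (g : Type*) [LieRing g] [LieAlgebra k g]

local notation "U" => UniversalEnvelopingAlgebra k g

lemma mk_surj : Function.Surjective (UniversalEnvelopingAlgebra.mkAlgHom k g) :=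
  RingCon.mk'_surjective (UniversalEnvelopingAlgebra.ringCon k g)

/-- The adjoint bracket on the enveloping algebra. -/
noncomputable def adj (x : g) (u : U) : U :=
  UniversalEnvelopingAlgebra.ι k x * u - u * UniversalEnvelopingAlgebra.ι k x

lemma ι_lie (x y : g) : UniversalEnvelopingAlgebra.ι k ⁅x, y⁆ =
    UniversalEnvelopingAlgebra.ι k x * UniversalEnvelopingAlgebra.ι k y -
    UniversalEnvelopingAlgebra.ι k y * UniversalEnvelopingAlgebra.ι k x := by
  rw [LieHom.map_lie, LieRing.of_associative_ring_bracket]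

/-- The adjoint action. -/
noncomputable instance : LieRingModule g U where
  bracket x u := adj k g x u
  add_lie x y u := by
    change adj k g _ _ = adj k g _ _ + adj k g _ _
    simp only [adj, map_add]; noncomm_ring
  lie_add x u v := by
    change adj k g _ _ = adj k g _ _ + adj k g _ _
    simp only [adj]; noncomm_ring
  leibniz_lie x y u := by
    change adj k g _ (adj k g _ _) = adj k g _ _ + adj k g _ (adj k g _ _)
    simp only [adj, ι_lie]; noncomm_ring

lemma adj_def (x : g) (u : U) : ⁅x, u⁆ =
  UniversalEnvelopingAlgebra.ι k x * u - u * UniversalEnvelopingAlgebra.ι k x := rfl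

instance : LieModule k g U where
  smul_lie t x u := by simp [adj_def, smul_sub]
  lie_smul t x u := by simp [adj_def, smul_sub]

lemma lie_mul' (x : g) (u v : U) : ⁅x, u * v⁆ = ⁅x, u⁆ * v + u * ⁅x, v⁆ := by
  simp only [adj_def]; noncomm_ring

variable {k g}
theorem uea_induction {P : U → Prop}
    (halg : ∀ r : k, P (algebraMap k U r)) (hι : ∀ x : g, P (UniversalEnvelopingAlgebra.ι k x))
    (hmul : ∀ a b, P a → P b → P (a * b)) (hadd : ∀ a b, P a → P b → P (a + b)) (u : U) : P u := by
  obtain ⟨t, rfl⟩ := mk_surj k g u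
  induction t using TensorAlgebra.induction with
  | algebraMap r => rw [AlgHom.commutes]; exact halg r
  | ι x => exact hι x
  | mul a b ha hb => rw [map_mul]; exact hmul _ _ ha hb
  | add a b ha hb => rw [map_add]; exact hadd _ _ ha hb

/-- Local finiteness of the adjoint action. -/
lemma locally_finite [FiniteDimensional k g] (u : U) :
    ∃ N : LieSubmodule k g U, N.toSubmodule.FG ∧ u ∈ N := by
  induction u using uea_induction with
  | halg r =>
    refine ⟨{ Submodule.span k {(1 : U)} with lie_mem := ?_ },
      Submodule.fg_span (Set.finite_singleton _), ?_⟩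
    · intro x m hm
      obtain ⟨a, rfl⟩ := Submodule.mem_span_singleton.1 hm
      change ⁅x, a • (1 : U)⁆ ∈ Submodule.span k {(1 : U)}
      simp [adj_def]
    · change _ ∈ Submodule.span k {(1 : U)}
      rw [Algebra.algebraMap_eq_smul_one]
      exact Submodule.smul_mem _ _ (Submodule.mem_span_singleton_self _)
  | hι x =>
    refine ⟨{ LinearMap.range (UniversalEnvelopingAlgebra.ι k (L := g)).toLinearMap with
      lie_mem := ?_ }, ?_, ⟨x, rfl⟩⟩
    · rintro x _ ⟨y, rfl⟩
      exact ⟨⁅x, y⁆, ι_lie k g x y⟩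
    · change (LinearMap.range (UniversalEnvelopingAlgebra.ι k (L := g)).toLinearMap).FG
      rw [LinearMap.range_eq_map]
      exact (Module.finite_def.1 inferInstance : (⊤ : Submodule k g).FG).map _
  | hmul a b ha hb =>
    obtain ⟨M, hM, ha⟩ := ha
    obtain ⟨N, hN, hb⟩ := hb
    refine ⟨{ M.toSubmodule * N.toSubmodule with lie_mem := ?_ }, hM.mul hN,
      Submodule.mul_mem_mul ha hb⟩
    intro x m hm
    change m ∈ M.toSubmodule * N.toSubmodule at hm
    change ⁅x, m⁆ ∈ M.toSubmodule * N.toSubmodule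
    induction hm using Submodule.mul_induction_on' with
    | mem_mul_mem a ha b hb =>
      rw [lie_mul']
      exact add_mem (Submodule.mul_mem_mul (M.lie_mem ha) hb)
        (Submodule.mul_mem_mul ha (N.lie_mem hb))
    | add a _ b _ ha hb => rw [lie_add]; exact add_mem ha hb
  | hadd a b ha hb =>
    obtain ⟨M, hM, ha⟩ := ha
    obtain ⟨N, hN, hb⟩ := hb
    refine ⟨M ⊔ N, ?_, add_mem (le_sup_left (a := M) ha) (le_sup_right (b := N) hb)⟩
    rw [LieSubmodule.sup_toSubmodule]
    exact hM.sup hN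

lemma center_eq : Subalgebra.toSubmodule (Subalgebra.center k U) =
    (LieModule.maxTrivSubmodule k g U).toSubmodule := by
  ext z
  constructor
  · intro hz x
    have := ((Subalgebra.mem_center_iff (R := k)).1 hz) (UniversalEnvelopingAlgebra.ι k x)
    rw [adj_def, this, sub_self]
  · intro hz
    rw [Subalgebra.mem_toSubmodule, Subalgebra.mem_center_iff]
    intro b
    induction b using uea_induction with
    | halg r => exact Algebra.commutes r z
    | hι x => exact sub_eq_zero.1 (hz x)
    | hmul a b ha hb => rw [mul_assoc, hb, ← mul_assoc, ha, mul_assoc]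
    | hadd a b ha hb => rw [add_mul, mul_add, ha, hb]

lemma comm_eq : Submodule.span k {z : U | ∃ x y : U, z = x * y - y * x} = cov k g U := by
  apply le_antisymm
  · rw [Submodule.span_le]
    rintro _ ⟨a, c, rfl⟩
    change a * c - c * a ∈ cov k g U
    induction a using uea_induction generalizing c with
    | halg r => rw [Algebra.commutes r c, sub_self]; exact zero_mem _
    | hι x => exact Submodule.subset_span ⟨x, c, rfl⟩
    | hmul a b ha hb =>
      have : a * b * c - c * (a * b) = (a * (b * c) - (b * c) * a) + (b * (c * a) - (c * a) * b) := by
        noncomm_ring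
      rw [this]
      exact add_mem (ha _) (hb _)
    | hadd a b ha hb =>
      have : (a + b) * c - c * (a + b) = (a * c - c * a) + (b * c - c * b) := by noncomm_ring
      rw [this]
      exact add_mem (ha _) (hb _)
  · rw [cov, Submodule.span_le]
    rintro _ ⟨x, c, rfl⟩
    exact Submodule.subset_span ⟨_, c, rfl⟩

lemma cov_local [FiniteDimensional k g] {u : U} (hu : u ∈ cov k g U) :
    ∃ N : LieSubmodule k g U, N.toSubmodule.FG ∧ ∃ a : N, a ∈ cov k g N ∧ (a : U) = u := by
  have mono : ∀ (M N : LieSubmodule k g U) (h : M ≤ N) (a : M), a ∈ cov k g M →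
      (⟨a, h a.2⟩ : N) ∈ cov k g N := by
    intro M N h a ha
    have : cov k g M ≤ (cov k g N).comap (Submodule.inclusion (p := M.toSubmodule)
        (p' := N.toSubmodule) h) := by
      conv_lhs => rw [cov]
      rw [Submodule.span_le]
      rintro _ ⟨x, v, rfl⟩
      exact Submodule.subset_span ⟨x, ⟨v, h v.2⟩, rfl⟩
    exact this ha
  rw [cov] at hu
  induction hu using Submodule.span_induction with
  | mem z hz =>
    obtain ⟨x, v, rfl⟩ := hz
    obtain ⟨N, hN, hv⟩ := locally_finite v
    exact ⟨N, hN, ⁅x, (⟨v, hv⟩ : N)⁆, Submodule.subset_span ⟨x, _, rfl⟩, rfl⟩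
  | zero => exact ⟨⊥, by simpa using Submodule.fg_bot, 0, zero_mem _, rfl⟩
  | add a c _ _ ha hc =>
    obtain ⟨M, hM, a, ha, rfl⟩ := ha
    obtain ⟨N, hN, c, hc, rfl⟩ := hc
    refine ⟨M ⊔ N, ?_, _, add_mem (mono M (M ⊔ N) le_sup_left a ha)
      (mono N (M ⊔ N) le_sup_right c hc), rfl⟩
    rw [LieSubmodule.sup_toSubmodule]
    exact hM.sup hN
  | smul t a _ ha =>
    obtain ⟨M, hM, a, ha, rfl⟩ := ha
    exact ⟨M, hM, t • a, Submodule.smul_mem _ _ ha, rfl⟩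

theorem main [CharZero k] [FiniteDimensional k g] [LieAlgebra.IsKilling k g] :
    IsCompl (LieModule.maxTrivSubmodule k g U).toSubmodule (cov k g U) := by
  refine ⟨?_, ?_⟩
  · rw [Submodule.disjoint_def]
    intro v hv hvc
    obtain ⟨N, hN, a, ha, rfl⟩ := cov_local hvc
    have : FiniteDimensional k N := Module.Finite.iff_fg.2 hN
    have hai : a ∈ (LieModule.maxTrivSubmodule k g N).toSubmodule :=
      fun x => Subtype.ext (hv x)
    rw [(Submodule.disjoint_def.1 (weyl _ N rfl).disjoint) a hai ha]
    rfl
  · rw [codisjoint_iff, eq_top_iff]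
    intro v _
    obtain ⟨N, hN, hv⟩ := locally_finite v
    have : FiniteDimensional k N := Module.Finite.iff_fg.2 hN
    have ha : (⟨v, hv⟩ : N) ∈ (LieModule.maxTrivSubmodule k g N).toSubmodule ⊔ cov k g N := by
      rw [(weyl _ N rfl).sup_eq_top]; trivial
    obtain ⟨b, hb, c, hc, hbc⟩ := Submodule.mem_sup.1 ha
    have : v = b + c := (congrArg Subtype.val hbc).symm
    rw [this]
    refine Submodule.add_mem_sup (fun x => congrArg Subtype.val (hb x)) ?_
    have hle : cov k g N ≤ (cov k g U).comap N.toSubmodule.subtype := by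
      conv_lhs => rw [cov]
      rw [Submodule.span_le]
      rintro _ ⟨x, v, rfl⟩
      exact Submodule.subset_span ⟨x, v, rfl⟩
    exact hle hc

end uea
end UEAux


/-- STATEMENT 15: for a finite-dimensional semisimple Lie algebra `𝔤` over a field of
characteristic `0`, the universal enveloping algebra decomposes as a direct sum of vector
spaces `U(𝔤) = Z(U(𝔤)) ⊕ [U(𝔤), U(𝔤)]`, where `Z(U(𝔤))` is the center and `[U(𝔤), U(𝔤)]` is
the linear span of commutators. -/
theorem ue_center_compl_commutators {k : Type*} [Field k] [CharZero k]
    {g : Type*} [LieRing g] [LieAlgebra k g] [FiniteDimensional k g]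
    [LieAlgebra.IsSemisimple k g] :
    IsCompl
      (Subalgebra.toSubmodule (Subalgebra.center k (UniversalEnvelopingAlgebra k g)))
      (Submodule.span k
        {z : UniversalEnvelopingAlgebra k g |
          ∃ x y : UniversalEnvelopingAlgebra k g, z = x * y - y * x}) := by
  rw [UEAux.center_eq, UEAux.comm_eq]
  exact UEAux.main
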